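/- Let E be a finite-dimensional real inner product space, X ⊆ E compact convex and L > 0. Let f : E → ℝ be differentiable, convex on X, with gradient L-Lipschitz on X, and let g : E → ℝ be convex on X and lower semicontinuous. Let x ∈ X and let x⁺ be a minimizer over X of y ↦ ⟨∇f(x), y − x⟩ + (L/2)‖y − x‖² + g(y). Then for every z ∈ X, (f + g)(x⁺) − (f + g)(z) ≤ (L/2)‖x − z‖². -/

import Mathlib

open scoped RealInnerProductSpace

lemma Differentiable.hasDerivAt_comp_add_smul
    {E : Type*} [NormedAddCommGroup E] [InnerProductSpace ℝ E] [CompleteSpace E]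
    {f : E → ℝ} (hf : Differentiable ℝ f) (x v : E) (t : ℝ) :
    HasDerivAt (fun s : ℝ => f (x + s • v)) ⟪gradient f (x + t • v), v⟫ t := by
  have hline : HasDerivAt (fun s : ℝ => x + s • v) v t := by
    simpa using ((hasDerivAt_id t).smul_const v).const_add x
  exact (hf (x + t • v)).hasGradientAt.hasFDerivAt.comp_hasDerivAt t hline

/-- The descent lemma on a convex set. -/
lemma Convex.le_add_inner_gradient_add_sq
    {E : Type*} [NormedAddCommGroup E] [InnerProductSpace ℝ E] [CompleteSpace E]
    {X : Set E} (hX : Convex ℝ X) {L : ℝ} {f : E → ℝ} (hf : Differentiable ℝ f)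
    (hlip : ∀ x ∈ X, ∀ y ∈ X, ‖gradient f x - gradient f y‖ ≤ L * ‖x - y‖)
    {x y : E} (hx : x ∈ X) (hy : y ∈ X) :
    f y ≤ f x + ⟪gradient f x, y - x⟫ + L / 2 * ‖y - x‖ ^ 2 := by
  set v := y - x with hv
  let φ : ℝ → ℝ := fun t => f (x + t • v) - (t * ⟪gradient f x, v⟫ + L / 2 * ‖v‖ ^ 2 * t ^ 2)
  have hφ (t : ℝ) : HasDerivAt φ
      (⟪gradient f (x + t • v), v⟫ - (⟪gradient f x, v⟫ + L * ‖v‖ ^ 2 * t)) t := by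
    refine (hf.hasDerivAt_comp_add_smul x v t).sub ?_
    refine (((hasDerivAt_id' t).mul_const ⟪gradient f x, v⟫).add
      ((hasDerivAt_pow 2 t).const_mul (L / 2 * ‖v‖ ^ 2))).congr_deriv ?_
    push_cast
    ring
  have hanti : AntitoneOn φ (Set.Icc 0 1) := by
    refine antitoneOn_of_deriv_nonpos (convex_Icc 0 1)
      (fun t _ => (hφ t).continuousAt.continuousWithinAt)
      (fun t _ => (hφ t).differentiableAt.differentiableWithinAt) fun t ht => ?_
    have ht' : t ∈ Set.Icc (0 : ℝ) 1 := interior_subset ht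
    have hbound := hlip _ (hX.add_smul_sub_mem hx hy ht') x hx
    rw [← hv, add_sub_cancel_left, norm_smul, Real.norm_of_nonneg ht'.1] at hbound
    have hinner := real_inner_le_norm (gradient f (x + t • v) - gradient f x) v
    have hmul := mul_le_mul_of_nonneg_right hbound (norm_nonneg v)
    rw [inner_sub_left] at hinner
    rw [(hφ t).deriv]
    linarith
  have h := hanti (Set.left_mem_Icc.2 zero_le_one) (Set.right_mem_Icc.2 zero_le_one) zero_le_one
  simp only [φ, hv, one_smul, zero_smul, add_zero, add_sub_cancel] at h
  linarith

/-- The first-order lower bound for a function that is convex on a set. -/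
lemma ConvexOn.add_inner_gradient_le
    {E : Type*} [NormedAddCommGroup E] [InnerProductSpace ℝ E] [CompleteSpace E]
    {X : Set E} {f : E → ℝ} (hconv : ConvexOn ℝ X f) (hf : Differentiable ℝ f)
    {x y : E} (hx : x ∈ X) (hy : y ∈ X) :
    f x + ⟪gradient f x, y - x⟫ ≤ f y := by
  have hline : ConvexOn ℝ (Set.Icc 0 1) (fun t : ℝ => f (x + t • (y - x))) := by
    refine ⟨convex_Icc 0 1, fun s hs t ht a b ha hb hab => ?_⟩
    have hcomb : x + (a • s + b • t) • (y - x) =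
        a • (x + s • (y - x)) + b • (x + t • (y - x)) := by
      obtain rfl : b = 1 - a := by linarith
      simp only [smul_eq_mul]
      module
    simp only [hcomb]
    exact hconv.2 (hconv.1.add_smul_sub_mem hx hy hs) (hconv.1.add_smul_sub_mem hx hy ht) ha hb hab
  have h := hline.le_slope_of_hasDerivAt (Set.left_mem_Icc.2 zero_le_one)
    (Set.right_mem_Icc.2 zero_le_one) zero_lt_one (hf.hasDerivAt_comp_add_smul x (y - x) 0)
  simp only [slope_def_field, one_smul, zero_smul, add_zero, add_sub_cancel, sub_zero,
    div_one] at h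
  linarith

/-- **Composite warm start for one CRGD step, Euclidean instance.** Corollary D.9 of
"Implicit Riemannian Optimism with Applications to Min-Max Problems". -/
theorem crgd_composite_warm_start
    {E : Type*} [NormedAddCommGroup E] [InnerProductSpace ℝ E] [FiniteDimensional ℝ E]
    (X : Set E) (hXcomp : IsCompact X) (hXconv : Convex ℝ X)
    (L : ℝ) (hL : 0 < L)
    (f g : E → ℝ) (hf : Differentiable ℝ f) (hfconv : ConvexOn ℝ X f)
    (hflip : ∀ x ∈ X, ∀ y ∈ X, ‖gradient f x - gradient f y‖ ≤ L * ‖x - y‖)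
    (hgconv : ConvexOn ℝ X g) (hglsc : LowerSemicontinuous g)
    (x : E) (hx : x ∈ X)
    (xp : E) (hxpmem : xp ∈ X)
    (hxpmin : IsMinOn (fun y => ⟪gradient f x, y - x⟫ + L / 2 * ‖y - x‖ ^ 2 + g y) X xp) :
    ∀ z ∈ X, f xp + g xp - (f z + g z) ≤ L / 2 * ‖x - z‖ ^ 2 := by
  intro z hz
  have hdescent := hXconv.le_add_inner_gradient_add_sq hf hflip hx hxpmem
  have hlower := hfconv.add_inner_gradient_le hf hx hz
  have hmin := isMinOn_iff.1 hxpmin z hz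
  rw [norm_sub_rev x z]
  linarith
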